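/- Let p ∈ (1,∞) with p ≠ 2. A collection of maps α = {α_x : [−1,1] → ℝ³}_{x∈ℝ³} is a rigid motion of ℓ_{2,p}³ if and only if α_0 : [−1,1] → ℝ³ is continuous with α_0(0) = 0 and there exists a continuous map θ : [−1,1] → ℝ with θ(0) = 0 such that α_x(t) = R_{θ(t)} x + α_0(t) for every x ∈ ℝ³ and every t ∈ [−1,1]. -/

import Mathlib

/-- The mixed (2,p)-norm on ℝ³: ‖(x,y,z)‖_{2,p} = ((x²+y²)^{p/2} + |z|^p)^{1/p}. -/
noncomputable def norm2p (p : ℝ) (v : Fin 3 → ℝ) : ℝ :=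
  ((v 0 ^ 2 + v 1 ^ 2) ^ (p / 2) + |v 2| ^ p) ^ (1 / p)

/-- Rotation by angle θ about the z-axis. -/
noncomputable def Rot (θ : ℝ) (x : Fin 3 → ℝ) : Fin 3 → ℝ :=
  ![x 0 * Real.cos θ - x 1 * Real.sin θ, x 0 * Real.sin θ + x 1 * Real.cos θ, x 2]

/-- α = {α_x : [−1,1] → ℝ³} is a rigid motion of ℓ_{2,p}³: each α_x is continuous,
α_x(0) = x, and ‖α_x(t) − α_y(t)‖_{2,p} = ‖x − y‖_{2,p} for all x, y and t ∈ [−1,1]. -/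
def RigidMotion (p : ℝ) (α : (Fin 3 → ℝ) → ℝ → (Fin 3 → ℝ)) : Prop :=
  (∀ x, ContinuousOn (α x) (Set.Icc (-1) 1)) ∧
  (∀ x, α x 0 = x) ∧
  (∀ x y, ∀ t ∈ Set.Icc (-1 : ℝ) 1, norm2p p (α x t - α y t) = norm2p p (x - y))

/-- The space `ℂ × ℝ` with the `ℓ_p` product norm, an isometric model of `ℓ_{2,p}³`. -/
abbrev MixedSpace (p : ℝ) := WithLp (ENNReal.ofReal p) (ℂ × ℝ)

/-- The identification of `ℝ³` with `ℂ × ℝ`. -/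
def toMixed (p : ℝ) (v : Fin 3 → ℝ) : MixedSpace p :=
  WithLp.toLp _ (⟨v 0, v 1⟩, v 2)

/-- The inverse of `toMixed`. -/
def ofMixed (p : ℝ) (X : MixedSpace p) : Fin 3 → ℝ :=
  ![X.fst.re, X.fst.im, X.snd]

theorem ofMixed_toMixed (p : ℝ) (v : Fin 3 → ℝ) : ofMixed p (toMixed p v) = v := by
  ext i
  fin_cases i <;> rfl

theorem toMixed_ofMixed (p : ℝ) (X : MixedSpace p) : toMixed p (ofMixed p X) = X := rfl

theorem toMixed_sub (p : ℝ) (v w : Fin 3 → ℝ) :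
    toMixed p (v - w) = toMixed p v - toMixed p w := rfl

theorem toReal_ofReal_of_one_lt {p : ℝ} (hp : 1 < p) : (ENNReal.ofReal p).toReal = p :=
  ENNReal.toReal_ofReal (by linarith)

theorem MixedSpace.norm_eq {p : ℝ} (hp : 1 < p) (X : MixedSpace p) :
    ‖X‖ = (‖X.fst‖ ^ p + ‖X.snd‖ ^ p) ^ (1 / p) := by
  have h := toReal_ofReal_of_one_lt hp
  rw [WithLp.prod_norm_eq_add (by rw [h]; linarith), h]

theorem MixedSpace.norm_rpow {p : ℝ} (hp : 1 < p) (X : MixedSpace p) :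
    ‖X‖ ^ p = ‖X.fst‖ ^ p + ‖X.snd‖ ^ p := by
  rw [MixedSpace.norm_eq hp, one_div, Real.rpow_inv_rpow (by positivity) (by linarith)]

theorem norm_toMixed {p : ℝ} (hp : 1 < p) (v : Fin 3 → ℝ) : ‖toMixed p v‖ = norm2p p v := by
  rw [MixedSpace.norm_eq hp, norm2p]
  congr 2
  change ‖(⟨v 0, v 1⟩ : ℂ)‖ ^ p = _
  rw [Complex.norm_eq_sqrt_sq_add_sq, Real.sqrt_eq_rpow, ← Real.rpow_mul (by positivity)]
  congr 1
  ring

theorem norm_add_rpow_lt {F : Type*} [NormedAddCommGroup F] [NormedSpace ℝ F]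
    [StrictConvexSpace ℝ F] {p : ℝ} (hp : 1 < p) {x y : F} (h : x ≠ y) :
    (‖x + y‖ / 2) ^ p < (‖x‖ ^ p + ‖y‖ ^ p) / 2 := by
  by_cases hn : ‖x‖ = ‖y‖
  · have h1 := (norm_midpoint_lt_iff hn).2 h
    rw [norm_smul] at h1
    norm_num at h1
    have := Real.rpow_lt_rpow (by positivity) (show ‖x + y‖ / 2 < ‖x‖ by linarith)
      (show 0 < p by linarith)
    rw [← hn]
    linarith
  · have h1 := (strictConvexOn_rpow hp).2 (norm_nonneg x) (norm_nonneg y) hn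
      (show (0 : ℝ) < 1 / 2 by norm_num) (show (0 : ℝ) < 1 / 2 by norm_num) (by norm_num)
    simp only [smul_eq_mul] at h1
    have h2 : (‖x + y‖ / 2) ^ p ≤ (1 / 2 * ‖x‖ + 1 / 2 * ‖y‖) ^ p := by
      apply Real.rpow_le_rpow (by positivity) _ (by linarith)
      linarith [norm_add_le x y]
    linarith

theorem norm_add_rpow_le {F : Type*} [NormedAddCommGroup F] [NormedSpace ℝ F]
    [StrictConvexSpace ℝ F] {p : ℝ} (hp : 1 < p) (x y : F) :
    (‖x + y‖ / 2) ^ p ≤ (‖x‖ ^ p + ‖y‖ ^ p) / 2 := by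
  by_cases h : x = y
  · subst h
    rw [← two_smul ℝ x, norm_smul]
    norm_num
  · exact (norm_add_rpow_lt hp h).le

theorem MixedSpace.strictConvexSpace {p : ℝ} (hp : 1 < p) [Fact (1 ≤ ENNReal.ofReal p)] :
    StrictConvexSpace ℝ (MixedSpace p) := by
  refine StrictConvexSpace.of_norm_add_ne_two fun X Y hX hY hne h => ?_
  have e1 := MixedSpace.norm_rpow hp X
  have e2 := MixedSpace.norm_rpow hp Y
  have e3 := MixedSpace.norm_rpow hp (X + Y)
  rw [hX, Real.one_rpow] at e1
  rw [hY, Real.one_rpow] at e2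
  rw [h, WithLp.add_fst, WithLp.add_snd] at e3
  have h2 : (0 : ℝ) < 2 ^ p := by positivity
  have key : (‖X.fst + Y.fst‖ / 2) ^ p + (‖X.snd + Y.snd‖ / 2) ^ p = 1 := by
    rw [Real.div_rpow (by positivity) (by norm_num), Real.div_rpow (by positivity) (by norm_num),
      ← add_div, ← e3, div_self h2.ne']
  have l1 := norm_add_rpow_le hp X.fst Y.fst
  have l2 := norm_add_rpow_le hp X.snd Y.snd
  by_cases h1 : X.fst = Y.fst
  · have h3 : X.snd ≠ Y.snd := fun h3 => hne (WithLp.ofLp_injective _ (Prod.ext h1 h3))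
    linarith [norm_add_rpow_lt hp h3]
  · linarith [norm_add_rpow_lt hp h1]

/-- The defect in the `p`-parallelogram (Clarkson) identity has the sign of `p - 2`, and vanishes
only when one of the vectors is zero. -/
theorem clarkson_defect {F : Type*} [NormedAddCommGroup F] [InnerProductSpace ℝ F]
    {p : ℝ} (hp : 1 < p) (hp2 : p ≠ 2) (u v : F) :
    0 ≤ (p - 2) * (‖u + v‖ ^ p + ‖u - v‖ ^ p - 2 * (‖u‖ ^ p + ‖v‖ ^ p)) ∧
      (u ≠ 0 → v ≠ 0 →
        0 < (p - 2) * (‖u + v‖ ^ p + ‖u - v‖ ^ p - 2 * (‖u‖ ^ p + ‖v‖ ^ p))) := by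
  have hsq : ∀ w : F, ‖w‖ ^ p = (‖w‖ ^ 2) ^ (p / 2) := fun w => by
    rw [← Real.rpow_natCast, ← Real.rpow_mul (norm_nonneg w)]
    congr 1
    push_cast
    ring
  suffices H : u ≠ 0 → v ≠ 0 →
      0 < (p - 2) * (‖u + v‖ ^ p + ‖u - v‖ ^ p - 2 * (‖u‖ ^ p + ‖v‖ ^ p)) by
    refine ⟨?_, H⟩
    have hp0 : p ≠ 0 := by linarith
    by_cases hu : u = 0
    · simp [hu, Real.zero_rpow hp0, two_mul]
    by_cases hv : v = 0
    · simp [hv, Real.zero_rpow hp0, two_mul]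
    exact (H hu hv).le
  intro hu hv
  have par : ‖u + v‖ ^ 2 + ‖u - v‖ ^ 2 = 2 * (‖u‖ ^ 2 + ‖v‖ ^ 2) := by
    have := parallelogram_law_with_norm ℝ u v
    nlinarith
  simp only [hsq]
  have ha : 0 < ‖u‖ ^ 2 := by positivity
  have hb : 0 < ‖v‖ ^ 2 := by positivity
  have hA : 0 ≤ ‖u + v‖ ^ 2 := by positivity
  have hB : 0 ≤ ‖u - v‖ ^ 2 := by positivity
  generalize ‖u + v‖ ^ 2 = A at *
  generalize ‖u - v‖ ^ 2 = B at *
  generalize ‖u‖ ^ 2 = a at *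
  generalize ‖v‖ ^ 2 = b at *
  have hS : 1 / 2 * A + 1 / 2 * B = a + b := by linarith
  have hsplit : ∀ x : ℝ, 0 < x → x ^ (p / 2) = x * x ^ (p / 2 - 1) := fun x hx => by
    rw [Real.rpow_sub_one hx.ne']
    field_simp
  rcases lt_or_gt_of_ne hp2 with h | h
  · have c := (Real.concaveOn_rpow (show 0 ≤ p / 2 by linarith) (by linarith)).2 hA hB
      (show (0 : ℝ) ≤ 1 / 2 by norm_num) (show (0 : ℝ) ≤ 1 / 2 by norm_num) (by norm_num)
    simp only [smul_eq_mul, hS] at c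
    have s1 := mul_lt_mul_of_pos_left (Real.rpow_lt_rpow_of_neg ha
      (show a < a + b by linarith) (show p / 2 - 1 < 0 by linarith)) ha
    have s2 := mul_lt_mul_of_pos_left (Real.rpow_lt_rpow_of_neg hb
      (show b < a + b by linarith) (show p / 2 - 1 < 0 by linarith)) hb
    apply mul_pos_of_neg_of_neg (by linarith)
    rw [hsplit _ ha, hsplit _ hb]
    rw [hsplit (a + b) (by linarith)] at c
    linarith
  · have c := (convexOn_rpow (show 1 ≤ p / 2 by linarith)).2 hA hB
      (show (0 : ℝ) ≤ 1 / 2 by norm_num) (show (0 : ℝ) ≤ 1 / 2 by norm_num) (by norm_num)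
    simp only [smul_eq_mul, hS] at c
    have s1 := mul_lt_mul_of_pos_left (Real.rpow_lt_rpow ha.le
      (show a < a + b by linarith) (show 0 < p / 2 - 1 by linarith)) ha
    have s2 := mul_lt_mul_of_pos_left (Real.rpow_lt_rpow hb.le
      (show b < a + b by linarith) (show 0 < p / 2 - 1 by linarith)) hb
    apply mul_pos (by linarith)
    rw [hsplit _ ha, hsplit _ hb]
    rw [hsplit (a + b) (by linarith)] at c
    linarith

/-- Linear isometries of `MixedSpace p` preserve disjointness of supports. -/
theorem LinearIsometry.mixed_disjoint {p : ℝ} (hp : 1 < p) (hp2 : p ≠ 2)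
    [Fact (1 ≤ ENNReal.ofReal p)] (L : MixedSpace p →ₗᵢ[ℝ] MixedSpace p) (w : ℂ) (s : ℝ) :
    ((L (WithLp.toLp _ (w, 0))).fst = 0 ∨ (L (WithLp.toLp _ (0, s))).fst = 0) ∧
      ((L (WithLp.toLp _ (w, 0))).snd = 0 ∨ (L (WithLp.toLp _ (0, s))).snd = 0) := by
  set X : MixedSpace p := WithLp.toLp _ (w, 0) with hX
  set Y : MixedSpace p := WithLp.toLp _ (0, s) with hY
  have hp0 : p ≠ 0 := by linarith
  have key : ‖L X + L Y‖ ^ p + ‖L X - L Y‖ ^ p = 2 * (‖L X‖ ^ p + ‖L Y‖ ^ p) := by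
    rw [← map_add, ← map_sub]
    simp only [L.norm_map, MixedSpace.norm_rpow hp, WithLp.add_fst, WithLp.add_snd,
      WithLp.sub_fst, WithLp.sub_snd, hX, hY]
    simp [Real.zero_rpow hp0]
    ring
  simp only [MixedSpace.norm_rpow hp, WithLp.add_fst, WithLp.add_snd,
      WithLp.sub_fst, WithLp.sub_snd] at key
  obtain ⟨c1, c2⟩ := clarkson_defect hp hp2 (L X).fst (L Y).fst
  obtain ⟨d1, d2⟩ := clarkson_defect hp hp2 (L X).snd (L Y).snd
  have hsum : (p - 2) * (‖(L X).fst + (L Y).fst‖ ^ p + ‖(L X).fst - (L Y).fst‖ ^ p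
        - 2 * (‖(L X).fst‖ ^ p + ‖(L Y).fst‖ ^ p))
      + (p - 2) * (‖(L X).snd + (L Y).snd‖ ^ p + ‖(L X).snd - (L Y).snd‖ ^ p
        - 2 * (‖(L X).snd‖ ^ p + ‖(L Y).snd‖ ^ p)) = 0 := by
    linear_combination (p - 2) * key
  constructor
  · by_contra! h
    linarith [c2 h.1 h.2]
  · by_contra! h
    linarith [d2 h.1 h.2]

theorem MixedSpace.norm_of_snd_eq_zero {p : ℝ} (hp : 1 < p) {X : MixedSpace p}
    (hX : X.snd = 0) : ‖X‖ = ‖X.fst‖ := by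
  have hp0 : p ≠ 0 := by linarith
  rw [MixedSpace.norm_eq hp, hX, norm_zero, Real.zero_rpow hp0, add_zero, one_div,
    Real.rpow_rpow_inv (norm_nonneg _) hp0]

theorem MixedSpace.norm_of_fst_eq_zero {p : ℝ} (hp : 1 < p) {X : MixedSpace p}
    (hX : X.fst = 0) : ‖X‖ = |X.snd| := by
  have hp0 : p ≠ 0 := by linarith
  rw [MixedSpace.norm_eq hp, hX, norm_zero, Real.zero_rpow hp0, zero_add, one_div,
    Real.rpow_rpow_inv (norm_nonneg _) hp0, Real.norm_eq_abs]

/-- Linear isometries of `MixedSpace p`, for `p ≠ 2`, are block diagonal. -/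
theorem LinearIsometry.mixed_blocks {p : ℝ} (hp : 1 < p) (hp2 : p ≠ 2)
    [Fact (1 ≤ ENNReal.ofReal p)] (L : MixedSpace p →ₗᵢ[ℝ] MixedSpace p) :
    (L (WithLp.toLp _ (0, 1))).fst = 0 ∧ ∀ w : ℂ, (L (WithLp.toLp _ (w, 0))).snd = 0 := by
  have hL0 : ∀ w : ℂ, (L (WithLp.toLp _ (w, 0))).fst = 0 →
      |(L (WithLp.toLp _ (w, 0))).snd| = ‖w‖ := fun w h => by
    rw [← MixedSpace.norm_of_fst_eq_zero hp h, L.norm_map, MixedSpace.norm_of_snd_eq_zero hp rfl]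
    rfl
  have h1 : (L (WithLp.toLp _ (0, 1))).fst = 0 := by
    by_contra hne
    have hB : ∀ w : ℂ, (L (WithLp.toLp _ (w, 0))).fst = 0 := fun w =>
      ((L.mixed_disjoint hp hp2 w 1).1).resolve_right hne
    have hsnd : ∀ a b : ℝ, |a * (L (WithLp.toLp _ (1, 0))).snd
        + b * (L (WithLp.toLp _ (Complex.I, 0))).snd| = ‖(a + b * Complex.I : ℂ)‖ := fun a b => by
      rw [← hL0 _ (hB _)]
      have : (WithLp.toLp _ ((a + b * Complex.I : ℂ), (0 : ℝ)) : MixedSpace p)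
          = a • WithLp.toLp _ (1, 0) + b • WithLp.toLp _ (Complex.I, 0) := by
        apply WithLp.ofLp_injective
        ext <;> simp
      rw [this, map_add, map_smul, map_smul]
      simp
    have i1 := hsnd (L (WithLp.toLp _ (Complex.I, 0))).snd (-(L (WithLp.toLp _ (1, 0))).snd)
    have i2 := hsnd 1 0
    rw [show ∀ a b : ℝ, a * b + -b * a = 0 by intros; ring, abs_zero] at i1
    have i3 := congrArg Complex.im (norm_eq_zero.1 i1.symm)
    simp at i3
    simp [i3] at i2
  refine ⟨h1, fun w => ((L.mixed_disjoint hp hp2 w 1).2).resolve_right fun h2 => ?_⟩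
  have h3 : L (WithLp.toLp _ (0, 1)) = 0 := WithLp.ofLp_injective _ (Prod.ext h1 h2)
  have h4 := L.norm_map (WithLp.toLp _ (0, 1))
  rw [h3, MixedSpace.norm_of_fst_eq_zero hp (X := WithLp.toLp _ (0, 1)) rfl] at h4
  simp at h4

/-- For `p ≠ 2`, a linear isometry of `MixedSpace p` is a planar linear isometry times a sign. -/
theorem LinearIsometry.mixed_form {p : ℝ} (hp : 1 < p) (hp2 : p ≠ 2)
    [Fact (1 ≤ ENNReal.ofReal p)] (L : MixedSpace p →ₗᵢ[ℝ] MixedSpace p) :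
    ∃ (c : ℂ) (δ σ : ℝ), ‖c‖ = 1 ∧ δ ^ 2 = 1 ∧ σ ^ 2 = 1 ∧
      ∀ X, (L X).fst = c * ⟨X.fst.re, δ * X.fst.im⟩ ∧ (L X).snd = σ * X.snd := by
  obtain ⟨h1, h2⟩ := L.mixed_blocks hp hp2
  let B : ℂ →ₗᵢ[ℝ] ℂ :=
    { toFun := fun w => (L (WithLp.toLp _ (w, 0))).fst
      map_add' := fun w z => by
        rw [← WithLp.add_fst, ← map_add, ← WithLp.toLp_add]
        simp
      map_smul' := fun r w => by
        rw [RingHom.id_apply, ← WithLp.smul_fst, ← map_smul, ← WithLp.toLp_smul]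
        simp
      norm_map' := fun w => by
        change ‖(L (WithLp.toLp _ (w, 0))).fst‖ = ‖w‖
        rw [← MixedSpace.norm_of_snd_eq_zero hp (h2 w), L.norm_map,
          MixedSpace.norm_of_snd_eq_zero hp rfl]
        rfl }
  have hσ : (L (WithLp.toLp _ (0, 1))).snd ^ 2 = 1 := by
    rw [← sq_abs, ← MixedSpace.norm_of_fst_eq_zero hp h1, L.norm_map,
      MixedSpace.norm_of_fst_eq_zero hp rfl]
    norm_num
  have hL : ∀ X, (L X).fst = B X.fst ∧ (L X).snd = (L (WithLp.toLp _ (0, 1))).snd * X.snd := by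
    intro X
    have : X = WithLp.toLp _ (X.fst, 0) + X.snd • WithLp.toLp _ (0, 1) := by
      apply WithLp.ofLp_injective
      ext <;> simp
    have h3 : L X = L (WithLp.toLp _ (X.fst, 0)) + X.snd • L (WithLp.toLp _ (0, 1)) := by
      rw [← map_smul, ← map_add, ← this]
    rw [h3]
    constructor
    · rw [WithLp.add_fst, WithLp.smul_fst, h1, smul_zero, add_zero]
      rfl
    · rw [WithLp.add_snd, WithLp.smul_snd, h2, zero_add, smul_eq_mul, mul_comm]
  obtain ⟨c, hc⟩ := linear_isometry_complex (B.toLinearIsometryEquiv rfl)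
  have hB : ∀ w, B w = B.toLinearIsometryEquiv rfl w := fun w => rfl
  rcases hc with hc | hc
  · refine ⟨c, 1, _, c.norm_coe, one_pow 2, hσ, fun X => ⟨?_, (hL X).2⟩⟩
    rw [(hL X).1, hB, hc, rotation_apply, one_mul]
  · refine ⟨c, -1, _, c.norm_coe, by norm_num, hσ, fun X => ⟨?_, (hL X).2⟩⟩
    rw [(hL X).1, hB, hc, LinearIsometryEquiv.trans_apply, rotation_apply, Complex.conjLIE_apply]
    congr 1
    apply Complex.ext <;> simp

/-- Distance-preserving self-maps of `ℓ_{2,p}³`, for `p ≠ 2`, in coordinates. -/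
theorem exists_coordinates_of_norm2p_isometry {p : ℝ} (hp : 1 < p) (hp2 : p ≠ 2)
    (f : (Fin 3 → ℝ) → Fin 3 → ℝ) (hf : ∀ x y, norm2p p (f x - f y) = norm2p p (x - y)) :
    ∃ a b δ σ : ℝ, a ^ 2 + b ^ 2 = 1 ∧ δ ^ 2 = 1 ∧ σ ^ 2 = 1 ∧
      ∀ x, f x - f 0 = ![a * x 0 - δ * b * x 1, b * x 0 + δ * a * x 1, σ * x 2] := by
  have : Fact (1 ≤ ENNReal.ofReal p) := ⟨by simpa using hp.le⟩
  have := MixedSpace.strictConvexSpace hp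
  have hi : Isometry fun X : MixedSpace p => toMixed p (f (ofMixed p X)) :=
    Isometry.of_dist_eq fun X Y => by
      rw [dist_eq_norm, dist_eq_norm, ← toMixed_sub, norm_toMixed hp, hf, ← norm_toMixed hp,
        toMixed_sub, toMixed_ofMixed, toMixed_ofMixed]
  obtain ⟨c, δ, σ, hc, hδ, hσ, hL⟩ :=
    hi.affineIsometryOfStrictConvexSpace.linearIsometry.mixed_form hp hp2
  refine ⟨c.re, c.im, δ, σ, ?_, hδ, hσ, fun x => ?_⟩
  · rw [← Complex.normSq_add_mul_I, Complex.re_add_im, Complex.normSq_eq_norm_sq, hc, one_pow]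
  · have h := hi.affineIsometryOfStrictConvexSpace.map_vsub (toMixed p x) (toMixed p 0)
    simp only [Isometry.affineIsometryOfStrictConvexSpace_apply, ofMixed_toMixed, vsub_eq_sub,
      ← toMixed_sub, sub_zero] at h
    obtain ⟨h1, h2⟩ := hL (toMixed p x)
    rw [h] at h1 h2
    have hre := congrArg Complex.re h1
    have him := congrArg Complex.im h1
    simp only [toMixed, Complex.mul_re, Complex.mul_im] at hre him h2
    ext i
    fin_cases i
    · exact hre.trans (by simp; ring)
    · exact him.trans (by simp; ring)
    · exact h2

/-- A continuous path of unit vectors in the plane has a continuous angle. -/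
theorem exists_continuous_angle {a b : ℝ → ℝ} (ha : ContinuousOn a (Set.Icc (-1) 1))
    (hb : ContinuousOn b (Set.Icc (-1) 1)) (hab : ∀ t ∈ Set.Icc (-1 : ℝ) 1, a t ^ 2 + b t ^ 2 = 1)
    (ha0 : a 0 = 1) (hb0 : b 0 = 0) :
    ∃ θ : ℝ → ℝ, Continuous θ ∧ θ 0 = 0 ∧
      ∀ t ∈ Set.Icc (-1 : ℝ) 1, a t = Real.cos (θ t) ∧ b t = Real.sin (θ t) := by
  have hI : (-1 : ℝ) ≤ 1 := by norm_num
  have hA : Continuous (Set.IccExtend hI ((Set.Icc (-1 : ℝ) 1).domRestrict a)) :=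
    ha.domRestrict.Icc_extend'
  have hB : Continuous (Set.IccExtend hI ((Set.Icc (-1 : ℝ) 1).domRestrict b)) :=
    hb.domRestrict.Icc_extend'
  set A := Set.IccExtend hI ((Set.Icc (-1 : ℝ) 1).domRestrict a)
  set B := Set.IccExtend hI ((Set.Icc (-1 : ℝ) 1).domRestrict b)
  have hAB : ∀ t, (A t + B t * Complex.I : ℂ) ∈ Submonoid.unitSphere ℂ := fun t => by
    have h : A t ^ 2 + B t ^ 2 = 1 := hab _ (Set.projIcc (-1) 1 hI t).2
    rw [Submonoid.unitSphere, ← SetLike.mem_coe, Submonoid.coe_set_mk, Subsemigroup.coe_set_mk,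
      mem_sphere_zero_iff_norm, ← sq_eq_sq₀ (norm_nonneg _) zero_le_one,
      ← Complex.normSq_eq_norm_sq, Complex.normSq_add_mul_I, h, one_pow]
  have hAe : ∀ t ∈ Set.Icc (-1 : ℝ) 1, A t = a t := fun t ht => Set.IccExtend_of_mem hI _ ht
  have hBe : ∀ t ∈ Set.Icc (-1 : ℝ) 1, B t = b t := fun t ht => Set.IccExtend_of_mem hI _ ht
  have h0 : (0 : ℝ) ∈ Set.Icc (-1 : ℝ) 1 := by norm_num
  let γ : C(ℝ, Circle) := ⟨fun t => ⟨A t + B t * Complex.I, hAB t⟩,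
    Continuous.subtype_mk (by fun_prop) _⟩
  obtain ⟨θ, ⟨hθ0, hθ⟩, -⟩ := Circle.isCoveringMap_exp.existsUnique_continuousMap_lifts γ (a₀ := 0)
    (e₀ := 0) (by
      apply Subtype.ext
      change _ = (A 0 + B 0 * Complex.I : ℂ)
      rw [hAe 0 h0, hBe 0 h0, ha0, hb0]
      simp)
  refine ⟨θ, θ.continuous, hθ0, fun t ht => ?_⟩
  have h : Complex.exp (θ t * Complex.I) = A t + B t * Complex.I :=
    (Circle.coe_exp _).symm.trans (congrArg Subtype.val (congrFun hθ t))
  rw [hAe t ht, hBe t ht, Complex.exp_mul_I] at h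
  have hre := congrArg Complex.re h
  have him := congrArg Complex.im h
  simp [Complex.cos_ofReal_re, Complex.sin_ofReal_re, Complex.cos_ofReal_im, Complex.sin_ofReal_im]
    at hre him
  exact ⟨hre.symm, him.symm⟩

/-- A continuous sign on `[-1, 1]` that is `1` at `0` is constantly `1`. -/
theorem eq_one_of_continuousOn_of_sq_eq_one {g : ℝ → ℝ} (hg : ContinuousOn g (Set.Icc (-1) 1))
    (hsq : ∀ t ∈ Set.Icc (-1 : ℝ) 1, g t ^ 2 = 1) (h0 : g 0 = 1) :
    ∀ t ∈ Set.Icc (-1 : ℝ) 1, g t = 1 := by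
  have := isPreconnected_Icc.eq_of_sq_eq hg (continuousOn_const (c := (1 : ℝ)))
    (fun t ht => by simpa using hsq t ht) (fun _ => one_ne_zero) (y := 0) (by norm_num) h0
  exact fun t ht => this ht

theorem continuous_rot (x : Fin 3 → ℝ) : Continuous fun θ => Rot θ x := by
  unfold Rot
  refine continuous_pi fun i => ?_
  fin_cases i
  · change Continuous fun θ => x 0 * Real.cos θ - x 1 * Real.sin θ
    fun_prop
  · change Continuous fun θ => x 0 * Real.sin θ + x 1 * Real.cos θ
    fun_prop
  · exact continuous_const

theorem rot_zero (x : Fin 3 → ℝ) : Rot 0 x = x := by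
  ext i
  fin_cases i <;> simp [Rot]

theorem norm2p_rot_sub (p θ : ℝ) (x y : Fin 3 → ℝ) :
    norm2p p (Rot θ x - Rot θ y) = norm2p p (x - y) := by
  have h : ((x 0 * Real.cos θ - x 1 * Real.sin θ) - (y 0 * Real.cos θ - y 1 * Real.sin θ)) ^ 2
      + ((x 0 * Real.sin θ + x 1 * Real.cos θ) - (y 0 * Real.sin θ + y 1 * Real.cos θ)) ^ 2
      = (x 0 - y 0) ^ 2 + (x 1 - y 1) ^ 2 := by
    linear_combination ((x 0 - y 0) ^ 2 + (x 1 - y 1) ^ 2) * Real.sin_sq_add_cos_sq θ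
  simp [norm2p, Rot, h]

/-- In a rigid motion of `ℓ_{2,p}³`, `p ≠ 2`, the time-`t` map is a rotation about the axis
followed by a translation. -/
theorem RigidMotion.exists_cos_sin {p : ℝ} (hp : 1 < p) (hp2 : p ≠ 2)
    {α : (Fin 3 → ℝ) → ℝ → Fin 3 → ℝ} (h : RigidMotion p α) :
    ∃ a b : ℝ → ℝ, ContinuousOn a (Set.Icc (-1) 1) ∧ ContinuousOn b (Set.Icc (-1) 1) ∧
      a 0 = 1 ∧ b 0 = 0 ∧ ∀ t ∈ Set.Icc (-1 : ℝ) 1, a t ^ 2 + b t ^ 2 = 1 ∧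
        ∀ x, α x t - α 0 t = ![a t * x 0 - b t * x 1, b t * x 0 + a t * x 1, x 2] := by
  obtain ⟨hcont, hzero, hiso⟩ := h
  have hc : ∀ x i, ContinuousOn (fun t => (α x t - α 0 t) i) (Set.Icc (-1) 1) := fun x i =>
    (continuous_apply i).comp_continuousOn ((hcont x).sub (hcont 0))
  let a : ℝ → ℝ := fun t => (α ![1, 0, 0] t - α 0 t) 0
  let b : ℝ → ℝ := fun t => (α ![1, 0, 0] t - α 0 t) 1
  let d : ℝ → ℝ := fun t =>
    a t * (α ![0, 1, 0] t - α 0 t) 1 - b t * (α ![0, 1, 0] t - α 0 t) 0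
  let s : ℝ → ℝ := fun t => (α ![0, 0, 1] t - α 0 t) 2
  have ha : ContinuousOn a (Set.Icc (-1) 1) := hc _ _
  have hb : ContinuousOn b (Set.Icc (-1) 1) := hc _ _
  have hd : ContinuousOn d (Set.Icc (-1) 1) := (ha.mul (hc _ _)).sub (hb.mul (hc _ _))
  have hs : ContinuousOn s (Set.Icc (-1) 1) := hc _ _
  have key : ∀ t ∈ Set.Icc (-1 : ℝ) 1, a t ^ 2 + b t ^ 2 = 1 ∧ d t ^ 2 = 1 ∧ s t ^ 2 = 1 ∧
      ∀ x, α x t - α 0 t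
        = ![a t * x 0 - d t * b t * x 1, b t * x 0 + d t * a t * x 1, s t * x 2] := by
    intro t ht
    obtain ⟨a', b', δ, σ, hab, hδ, hσ, hx⟩ := exists_coordinates_of_norm2p_isometry hp hp2
      (fun x => α x t) fun x y => hiso x y t ht
    have ea : a t = a' := by
      simp only [a, hx]
      simp
    have eb : b t = b' := by
      simp only [b, hx]
      simp
    have ed : d t = δ := by
      simp only [d, ea, eb, hx]
      simp
      linear_combination δ * hab
    have es : s t = σ := by
      simp only [s, hx]
      simp
    rw [ea, eb, ed, es]
    exact ⟨hab, hδ, hσ, hx⟩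
  have hd1 := eq_one_of_continuousOn_of_sq_eq_one hd (fun t ht => (key t ht).2.1)
    (by simp [d, a, b, hzero])
  have hs1 := eq_one_of_continuousOn_of_sq_eq_one hs (fun t ht => (key t ht).2.2.1)
    (by simp [s, hzero])
  refine ⟨a, b, ha, hb, by simp [a, hzero], by simp [b, hzero], fun t ht =>
    ⟨(key t ht).1, fun x => ?_⟩⟩
  rw [(key t ht).2.2.2 x, hd1 t ht, hs1 t ht]
  simp only [one_mul]

theorem stmt14 (p : ℝ) (hp1 : 1 < p) (hp2 : p ≠ 2)
    (α : (Fin 3 → ℝ) → ℝ → (Fin 3 → ℝ)) :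
    RigidMotion p α ↔
      (ContinuousOn (α 0) (Set.Icc (-1) 1) ∧ α 0 0 = 0 ∧
        ∃ θ : ℝ → ℝ, ContinuousOn θ (Set.Icc (-1) 1) ∧ θ 0 = 0 ∧
          ∀ x, ∀ t ∈ Set.Icc (-1 : ℝ) 1, α x t = Rot (θ t) x + α 0 t) := by
  constructor
  · intro h
    obtain ⟨a, b, ha, hb, ha0, hb0, hab⟩ := h.exists_cos_sin hp1 hp2
    obtain ⟨θ, hθ, hθ0, hcs⟩ := exists_continuous_angle ha hb (fun t ht => (hab t ht).1) ha0 hb0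
    refine ⟨h.1 0, h.2.1 0, θ, hθ.continuousOn, hθ0, fun x t ht => ?_⟩
    rw [← sub_eq_iff_eq_add, (hab t ht).2, (hcs t ht).1, (hcs t ht).2, Rot]
    simp only [mul_comm]
  · rintro ⟨hc, h0, θ, hθ, hθ0, h⟩
    refine ⟨fun x => ?_, fun x => ?_, fun x y t ht => ?_⟩
    · exact (((continuous_rot x).comp_continuousOn hθ).add hc).congr fun t ht => h x t ht
    · rw [h x 0 (by norm_num), hθ0, h0, rot_zero, add_zero]
    · rw [h x t ht, h y t ht, add_sub_add_right_eq_sub, norm2p_rot_sub]
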